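/- arXiv:2203.15964 — 2 statements merged into one kernel-verified Lean document; each statement's English description precedes it below -/
import Mathlib

section
/- There exists a (unique) 𝕜-algebra homomorphism ρ : NH_n → End_𝕜(𝕜[x_1,…,x_n]) such that ρ(x_j) is multiplication by x_j and ρ(ψ_j) is the divided difference operator ∂_j, where ∂_j(f) = (f − s_j f)/(x_j − x_{j+1}) and s_j f denotes f with the variables x_j and x_{j+1} exchanged (f − s_j f is always divisible by x_j − x_{j+1}, so ∂_j(f) is a polynomial). -/
open Classical

noncomputable section

/-- Generators of the nilHecke algebra `NH_n`: dots `x j` and crossings `psi j`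
(crossing strands `j, j+1`, 0-indexed). -/
inductive NHGen (n : ℕ) : Type
  | x : Fin n → NHGen n
  | psi : Fin (n - 1) → NHGen n

/-- The left strand position of the crossing `ψ_j`. -/
def lpos {n : ℕ} (j : Fin (n - 1)) : Fin n := Fin.castLE (n.sub_le 1) j

/-- The right strand position of the crossing `ψ_j`. -/
def rpos {n : ℕ} (j : Fin (n - 1)) : Fin n :=
  ⟨j.val + 1, by have := j.isLt; omega⟩

/-- The generator `x_j` of the free algebra on the nilHecke generators. -/
def XNf (𝕜 : Type) [Field 𝕜] (n : ℕ) (j : Fin n) : FreeAlgebra 𝕜 (NHGen n) :=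
  FreeAlgebra.ι 𝕜 (NHGen.x j)

/-- The generator `ψ_j` of the free algebra on the nilHecke generators. -/
def PNf (𝕜 : Type) [Field 𝕜] (n : ℕ) (j : Fin (n - 1)) : FreeAlgebra 𝕜 (NHGen n) :=
  FreeAlgebra.ι 𝕜 (NHGen.psi j)

/-- The defining relations of the nilHecke algebra `NH_n`. -/
inductive NHRel (𝕜 : Type) [Field 𝕜] (n : ℕ) :
    FreeAlgebra 𝕜 (NHGen n) → FreeAlgebra 𝕜 (NHGen n) → Prop
  | xx (j k : Fin n) :
      NHRel 𝕜 n (XNf 𝕜 n j * XNf 𝕜 n k) (XNf 𝕜 n k * XNf 𝕜 n j)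
  | psix (j : Fin (n - 1)) (k : Fin n) (h1 : k ≠ lpos j) (h2 : k ≠ rpos j) :
      NHRel 𝕜 n (PNf 𝕜 n j * XNf 𝕜 n k) (XNf 𝕜 n k * PNf 𝕜 n j)
  | psipsi (j k : Fin (n - 1)) (h : (j : ℕ) + 1 < (k : ℕ)) :
      NHRel 𝕜 n (PNf 𝕜 n j * PNf 𝕜 n k) (PNf 𝕜 n k * PNf 𝕜 n j)
  | psisq (j : Fin (n - 1)) :
      NHRel 𝕜 n (PNf 𝕜 n j * PNf 𝕜 n j) 0
  | braid (j k : Fin (n - 1)) (h : (j : ℕ) + 1 = (k : ℕ)) :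
      NHRel 𝕜 n (PNf 𝕜 n j * PNf 𝕜 n k * PNf 𝕜 n j)
        (PNf 𝕜 n k * PNf 𝕜 n j * PNf 𝕜 n k)
  | dot1 (j : Fin (n - 1)) :
      NHRel 𝕜 n (XNf 𝕜 n (lpos j) * PNf 𝕜 n j - PNf 𝕜 n j * XNf 𝕜 n (rpos j)) 1
  | dot2 (j : Fin (n - 1)) :
      NHRel 𝕜 n (PNf 𝕜 n j * XNf 𝕜 n (lpos j) - XNf 𝕜 n (rpos j) * PNf 𝕜 n j) 1

/-- The nilHecke algebra `NH_n`. -/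
abbrev NH (𝕜 : Type) [Field 𝕜] (n : ℕ) := RingQuot (NHRel 𝕜 n)

/-- The canonical map from the free algebra to `NH_n`. -/
def nhMk (𝕜 : Type) [Field 𝕜] (n : ℕ) : FreeAlgebra 𝕜 (NHGen n) →ₐ[𝕜] NH 𝕜 n :=
  RingQuot.mkAlgHom 𝕜 (NHRel 𝕜 n)

/-- The dot `x_j` in `NH_n`. -/
def xN (𝕜 : Type) [Field 𝕜] (n : ℕ) (j : Fin n) : NH 𝕜 n := nhMk 𝕜 n (XNf 𝕜 n j)

/-- The crossing `ψ_j` in `NH_n`. -/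
def pN (𝕜 : Type) [Field 𝕜] (n : ℕ) (j : Fin (n - 1)) : NH 𝕜 n := nhMk 𝕜 n (PNf 𝕜 n j)

/-- The adjacent transposition `s_j = (j, j+1)` of `𝔖_n` (0-indexed). -/
def sSwap {n : ℕ} (j : Fin (n - 1)) : Equiv.Perm (Fin n) :=
  Equiv.swap (lpos j) (rpos j)


namespace MvPolynomial

variable {σ R : Type*} [CommRing R]

theorem X_sub_X_ne_zero [Nontrivial R] {a b : σ} (h : a ≠ b) :
    (X a - X b : MvPolynomial σ R) ≠ 0 :=
  sub_ne_zero.2 fun hX => h (X_injective hX)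

variable [DecidableEq σ]

theorem rename_swap_rename_swap (a b : σ) (f : MvPolynomial σ R) :
    rename (Equiv.swap a b) (rename (Equiv.swap a b) f) = f := by
  rw [rename_rename, ← Equiv.coe_trans, ← Equiv.Perm.mul_def, Equiv.swap_mul_self]
  exact rename_id_apply f

theorem X_sub_X_dvd_sub_rename_swap (a b : σ) (f : MvPolynomial σ R) :
    (X a - X b : MvPolynomial σ R) ∣ f - rename (Equiv.swap a b) f := by
  induction f using MvPolynomial.induction_on with
  | C r => simp
  | add p q hp hq =>
    rw [map_add, add_sub_add_comm]
    exact dvd_add hp hq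
  | mul_X p i hp =>
    have hX : (X a - X b : MvPolynomial σ R) ∣ X i - X (Equiv.swap a b i) := by
      rcases eq_or_ne i a with rfl | ha
      · rw [Equiv.swap_apply_left]
      rcases eq_or_ne i b with rfl | hb
      · rw [Equiv.swap_apply_right, dvd_sub_comm]
      · simp [Equiv.swap_apply_of_ne_of_ne ha hb]
    rw [map_mul, rename_X]
    convert dvd_add (hp.mul_right (X i)) (hX.mul_left (rename (Equiv.swap a b) p)) using 1
    ring

variable [IsDomain R]

/-- The divided difference operator `f ↦ (f - s f) / (X a - X b)`, where `s` exchanges the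
distinct variables `X a` and `X b`. -/
def dividedDiff {a b : σ} (h : a ≠ b) : MvPolynomial σ R →ₗ[R] MvPolynomial σ R where
  toFun f := (X_sub_X_dvd_sub_rename_swap a b f).choose
  map_add' f g := mul_left_cancel₀ (X_sub_X_ne_zero h) <| by
    rw [mul_add, ← (X_sub_X_dvd_sub_rename_swap a b _).choose_spec,
      ← (X_sub_X_dvd_sub_rename_swap a b _).choose_spec,
      ← (X_sub_X_dvd_sub_rename_swap a b _).choose_spec, map_add, add_sub_add_comm]
  map_smul' r f := mul_left_cancel₀ (X_sub_X_ne_zero h) <| by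
    rw [RingHom.id_apply, mul_smul_comm, ← (X_sub_X_dvd_sub_rename_swap a b _).choose_spec,
      ← (X_sub_X_dvd_sub_rename_swap a b _).choose_spec, map_smul, smul_sub]

theorem dividedDiff_mul {a b : σ} (h : a ≠ b) (f : MvPolynomial σ R) :
    dividedDiff h f * (X a - X b) = f - rename (Equiv.swap a b) f := by
  rw [mul_comm]
  exact (X_sub_X_dvd_sub_rename_swap a b f).choose_spec.symm

theorem eq_dividedDiff {a b : σ} (h : a ≠ b) {f g : MvPolynomial σ R}
    (hg : g * (X a - X b) = f - rename (Equiv.swap a b) f) : g = dividedDiff h f :=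
  mul_right_cancel₀ (X_sub_X_ne_zero h) (hg.trans (dividedDiff_mul h f).symm)

theorem dividedDiff_symm {a b : σ} (h : a ≠ b) (f : MvPolynomial σ R) :
    dividedDiff h.symm f = -dividedDiff h f := by
  refine (eq_dividedDiff h.symm ?_).symm
  rw [Equiv.swap_comm]
  linear_combination dividedDiff_mul h f

theorem rename_swap_dividedDiff {a b : σ} (h : a ≠ b) (f : MvPolynomial σ R) :
    rename (Equiv.swap a b) (dividedDiff h f) = dividedDiff h f := by
  apply eq_dividedDiff h
  have key := congrArg (rename (Equiv.swap a b)) (dividedDiff_mul h f)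
  simp only [map_mul, map_sub, rename_X, Equiv.swap_apply_left, Equiv.swap_apply_right,
    rename_swap_rename_swap] at key
  linear_combination -key

theorem dividedDiff_dividedDiff_self {a b : σ} (h : a ≠ b) (f : MvPolynomial σ R) :
    dividedDiff h (dividedDiff h f) = 0 := by
  refine (eq_dividedDiff h ?_).symm
  rw [rename_swap_dividedDiff, sub_self, zero_mul]

theorem dividedDiff_X_mul_of_ne {a b c : σ} (h : a ≠ b) (ha : c ≠ a) (hb : c ≠ b)
    (f : MvPolynomial σ R) : dividedDiff h (X c * f) = X c * dividedDiff h f := by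
  refine (eq_dividedDiff h ?_).symm
  rw [map_mul, rename_X, Equiv.swap_apply_of_ne_of_ne ha hb]
  linear_combination X c * dividedDiff_mul h f

theorem dividedDiff_X_left_mul {a b : σ} (h : a ≠ b) (f : MvPolynomial σ R) :
    dividedDiff h (X a * f) = X b * dividedDiff h f + f := by
  refine (eq_dividedDiff h ?_).symm
  rw [map_mul, rename_X, Equiv.swap_apply_left]
  linear_combination X b * dividedDiff_mul h f

theorem dividedDiff_X_right_mul {a b : σ} (h : a ≠ b) (f : MvPolynomial σ R) :
    dividedDiff h (X b * f) = X a * dividedDiff h f - f := by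
  refine (eq_dividedDiff h ?_).symm
  rw [map_mul, rename_X, Equiv.swap_apply_right]
  linear_combination X a * dividedDiff_mul h f

theorem dividedDiff_comm {a b c d : σ} (hab : a ≠ b) (hcd : c ≠ d) (hac : a ≠ c) (had : a ≠ d)
    (hbc : b ≠ c) (hbd : b ≠ d) (f : MvPolynomial σ R) :
    dividedDiff hab (dividedDiff hcd f) = dividedDiff hcd (dividedDiff hab f) := by
  have h1 := congrArg (rename (Equiv.swap a b)) (dividedDiff_mul hcd f)
  have h2 := congrArg (rename (Equiv.swap c d)) (dividedDiff_mul hab f)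
  have hs : rename (Equiv.swap a b) (rename (Equiv.swap c d) f) =
      rename (Equiv.swap c d) (rename (Equiv.swap a b) f) := by
    rw [rename_rename, rename_rename]
    congr 2
    ext i
    simp only [Function.comp_apply, Equiv.swap_apply_def]
    grind
  simp only [map_mul, map_sub, rename_X, Equiv.swap_apply_of_ne_of_ne hac.symm hbc.symm,
    Equiv.swap_apply_of_ne_of_ne had.symm hbd.symm] at h1
  simp only [map_mul, map_sub, rename_X, Equiv.swap_apply_of_ne_of_ne hac had,
    Equiv.swap_apply_of_ne_of_ne hbc hbd] at h2
  refine mul_right_cancel₀ (mul_ne_zero (X_sub_X_ne_zero hab) (X_sub_X_ne_zero hcd)) ?_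
  linear_combination (X c - X d) * dividedDiff_mul hab (dividedDiff hcd f) +
    dividedDiff_mul hcd f - h1 - (X a - X b) * dividedDiff_mul hcd (dividedDiff hab f) -
    dividedDiff_mul hab f + h2 + hs

theorem dividedDiff_triple_mul {a b c : σ} (hab : a ≠ b) (hbc : b ≠ c) (hac : a ≠ c)
    (f : MvPolynomial σ R) :
    dividedDiff hab (dividedDiff hbc (dividedDiff hab f)) *
        ((X a - X b) * (X b - X c) * (X a - X c)) =
      f - rename (Equiv.swap a b) f - rename (Equiv.swap b c) f +
        rename (Equiv.swap b c) (rename (Equiv.swap a b) f) +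
        rename (Equiv.swap a b) (rename (Equiv.swap b c) f) - rename (Equiv.swap a c) f := by
  have h1 := congrArg (rename (Equiv.swap a b)) (dividedDiff_mul hbc (dividedDiff hab f))
  have h2 := congrArg (rename (Equiv.swap b c)) (dividedDiff_mul hab f)
  have h3 := congrArg (rename (Equiv.swap a b)) h2
  have hs : rename (Equiv.swap a b) (rename (Equiv.swap b c) (rename (Equiv.swap a b) f)) =
      rename (Equiv.swap a c) f := by
    rw [rename_rename, rename_rename]
    congr 2
    ext i
    simp only [Function.comp_apply, Equiv.swap_apply_def]
    grind
  simp only [map_mul, map_sub, rename_X, Equiv.swap_apply_left, Equiv.swap_apply_right,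
    Equiv.swap_apply_of_ne_of_ne hac.symm hbc.symm, Equiv.swap_apply_of_ne_of_ne hab hac,
    rename_swap_dividedDiff, hs] at h1 h2 h3
  linear_combination
    (X b - X c) * (X a - X c) * dividedDiff_mul hab (dividedDiff hbc (dividedDiff hab f)) +
    (X a - X c) * dividedDiff_mul hbc (dividedDiff hab f) - (X b - X c) * h1 +
    dividedDiff_mul hab f - h2 + h3

theorem dividedDiff_braid {a b c : σ} (hab : a ≠ b) (hbc : b ≠ c) (hac : a ≠ c)
    (f : MvPolynomial σ R) :
    dividedDiff hab (dividedDiff hbc (dividedDiff hab f)) =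
      dividedDiff hbc (dividedDiff hab (dividedDiff hbc f)) := by
  have h := dividedDiff_triple_mul hbc.symm hab.symm hac.symm f
  simp only [dividedDiff_symm hab, dividedDiff_symm hbc, map_neg, Equiv.swap_comm c b,
    Equiv.swap_comm b a, Equiv.swap_comm c a] at h
  refine mul_right_cancel₀ (mul_ne_zero (mul_ne_zero (X_sub_X_ne_zero hab) (X_sub_X_ne_zero hbc))
    (X_sub_X_ne_zero hac)) ?_
  linear_combination dividedDiff_triple_mul hab hbc hac f - h

end MvPolynomial

theorem lpos_ne_rpos {n : ℕ} (j : Fin (n - 1)) : lpos j ≠ rpos j := by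
  simp [lpos, rpos, Fin.ext_iff]

/-- The action of the nilHecke generators on polynomials. -/
def nhGenAction (𝕜 : Type) [Field 𝕜] (n : ℕ) :
    NHGen n → Module.End 𝕜 (MvPolynomial (Fin n) 𝕜)
  | .x j => LinearMap.mulLeft 𝕜 (MvPolynomial.X j)
  | .psi j => MvPolynomial.dividedDiff (lpos_ne_rpos j)

theorem nhGenAction_rel (𝕜 : Type) [Field 𝕜] (n : ℕ) ⦃u v : FreeAlgebra 𝕜 (NHGen n)⦄
    (h : NHRel 𝕜 n u v) :
    FreeAlgebra.lift 𝕜 (nhGenAction 𝕜 n) u = FreeAlgebra.lift 𝕜 (nhGenAction 𝕜 n) v := by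
  refine LinearMap.ext fun f => ?_
  cases h with
  | xx j k =>
    simp only [XNf, map_mul, FreeAlgebra.lift_ι_apply, nhGenAction, Module.End.mul_apply,
      LinearMap.mulLeft_apply]
    ring
  | psix j k h1 h2 =>
    simpa only [XNf, PNf, map_mul, FreeAlgebra.lift_ι_apply, nhGenAction, Module.End.mul_apply,
      LinearMap.mulLeft_apply] using MvPolynomial.dividedDiff_X_mul_of_ne _ h1 h2 f
  | psipsi j k h =>
    simp only [PNf, map_mul, FreeAlgebra.lift_ι_apply, nhGenAction, Module.End.mul_apply]
    apply MvPolynomial.dividedDiff_comm <;> simp only [lpos, rpos, ne_eq, Fin.ext_iff,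
      Fin.val_castLE] <;> omega
  | psisq j =>
    simpa only [PNf, map_mul, map_zero, FreeAlgebra.lift_ι_apply, nhGenAction,
      Module.End.mul_apply, LinearMap.zero_apply] using MvPolynomial.dividedDiff_dividedDiff_self _ f
  | braid j k h =>
    have hr : rpos j = lpos k := Fin.ext h
    have hj : lpos j ≠ lpos k := hr ▸ lpos_ne_rpos j
    have hjk : lpos j ≠ rpos k := by
      simp only [lpos, rpos, ne_eq, Fin.ext_iff, Fin.val_castLE]
      omega
    simp only [PNf, map_mul, FreeAlgebra.lift_ι_apply, nhGenAction, Module.End.mul_apply, hr]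
    exact MvPolynomial.dividedDiff_braid hj (lpos_ne_rpos k) hjk f
  | dot1 j =>
    simp only [XNf, PNf, map_mul, map_sub, map_one, FreeAlgebra.lift_ι_apply, nhGenAction,
      Module.End.mul_apply, LinearMap.sub_apply, LinearMap.mulLeft_apply, Module.End.one_apply,
      MvPolynomial.dividedDiff_X_right_mul]
    ring
  | dot2 j =>
    simp only [XNf, PNf, map_mul, map_sub, map_one, FreeAlgebra.lift_ι_apply, nhGenAction,
      Module.End.mul_apply, LinearMap.sub_apply, LinearMap.mulLeft_apply, Module.End.one_apply,
      MvPolynomial.dividedDiff_X_left_mul]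
    ring

/-- The polynomial representation of the nilHecke algebra. -/
def nhPolyRep (𝕜 : Type) [Field 𝕜] (n : ℕ) :
    NH 𝕜 n →ₐ[𝕜] Module.End 𝕜 (MvPolynomial (Fin n) 𝕜) :=
  RingQuot.liftAlgHom 𝕜 ⟨FreeAlgebra.lift 𝕜 (nhGenAction 𝕜 n), nhGenAction_rel 𝕜 n⟩

theorem nhPolyRep_xN (𝕜 : Type) [Field 𝕜] (n : ℕ) (j : Fin n) :
    nhPolyRep 𝕜 n (xN 𝕜 n j) = LinearMap.mulLeft 𝕜 (MvPolynomial.X j) := by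
  simp [nhPolyRep, xN, nhMk, XNf, nhGenAction]

theorem nhPolyRep_pN (𝕜 : Type) [Field 𝕜] (n : ℕ) (j : Fin (n - 1)) :
    nhPolyRep 𝕜 n (pN 𝕜 n j) = MvPolynomial.dividedDiff (lpos_ne_rpos j) := by
  simp [nhPolyRep, pN, nhMk, PNf, nhGenAction]

section Statement3

/-- there is a unique `𝕜`-algebra homomorphism
`ρ : NH_n → End_𝕜(𝕜[x_1,…,x_n])` sending `x_j` to multiplication by `x_j` and
`ψ_j` to the divided difference operator `∂_j`, characterized by
`∂_j(f)·(x_j − x_{j+1}) = f − s_j f`. -/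
theorem nilHecke_polynomial_representation (𝕜 : Type) [Field 𝕜] (n : ℕ) (hn : 1 ≤ n) :
    ∃! ρ : NH 𝕜 n →ₐ[𝕜] Module.End 𝕜 (MvPolynomial (Fin n) 𝕜),
      (∀ (j : Fin n) (f : MvPolynomial (Fin n) 𝕜),
        ρ (xN 𝕜 n j) f = MvPolynomial.X j * f) ∧
      (∀ (j : Fin (n - 1)) (f : MvPolynomial (Fin n) 𝕜),
        ρ (pN 𝕜 n j) f * (MvPolynomial.X (lpos j) - MvPolynomial.X (rpos j))
          = f - MvPolynomial.rename (⇑(sSwap j)) f) := by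
  refine ⟨nhPolyRep 𝕜 n, ⟨fun j f => ?_, fun j f => ?_⟩, fun ρ hρ => ?_⟩
  · rw [nhPolyRep_xN, LinearMap.mulLeft_apply]
  · rw [nhPolyRep_pN]
    exact MvPolynomial.dividedDiff_mul _ f
  · refine RingQuot.ringQuot_ext' 𝕜 _ _ (FreeAlgebra.hom_ext (funext fun g => ?_))
    refine LinearMap.ext fun f => ?_
    cases g with
    | x j =>
      exact (hρ.1 j f).trans (by rw [nhPolyRep_xN, LinearMap.mulLeft_apply] :
        _ = nhPolyRep 𝕜 n (xN 𝕜 n j) f)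
    | psi j =>
      exact (MvPolynomial.eq_dividedDiff (lpos_ne_rpos j) (hρ.2 j f)).trans
        (by rw [nhPolyRep_pN] : _ = nhPolyRep 𝕜 n (pN 𝕜 n j) f)

end Statement3

end
end

section
/- In the nilHecke algebra NH_n, the element e_n := x_1^{n−1} x_2^{n−2} ⋯ x_{n−1} ψ_{w_0} is an idempotent: e_n² = e_n, where w_0 is the longest element of 𝔖_n and ψ_{w_0} = ψ_{j_1}⋯ψ_{j_r} for any reduced expression s_{j_1}⋯s_{j_r} of w_0. -/
open Classical

noncomputable section

section Statement56

/-- The dot part `x_1^{n−1} x_2^{n−2} ⋯ x_{n−1}` of the idempotent `e_n` (0-indexed: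
the `j`-th dot appears with exponent `n − 1 − j`). -/
def nhDots (𝕜 : Type) [Field 𝕜] (n : ℕ) : NH 𝕜 n :=
  ((List.finRange n).map (fun j => xN 𝕜 n j ^ (n - 1 - j.val))).prod

/-- `e_n := x_1^{n−1} x_2^{n−2} ⋯ x_{n−1} ψ_{w_0}`, where `ψ_{w_0}` is given by a
word `L` of crossings. -/
def nhE (𝕜 : Type) [Field 𝕜] (n : ℕ) (L : List (Fin (n - 1))) : NH 𝕜 n :=
  nhDots 𝕜 n * (L.map (pN 𝕜 n)).prod

/-- The adjacent transposition `(j, j+1)` of `ℕ`. -/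
def adjSwap (j : ℕ) : Equiv.Perm ℕ := Equiv.swap j (j + 1)

/-- The permutation of `ℕ` represented by a word in the adjacent transpositions. -/
def wordPerm (L : List ℕ) : Equiv.Perm ℕ := (L.map adjSwap).prod

/-- The number of inversions of `w⁻¹` among the positions `0, …, n - 1`. -/
def invCount (n : ℕ) (w : Equiv.Perm ℕ) : ℕ :=
  ((Finset.range n ×ˢ Finset.range n).filter
    fun p => p.1 < p.2 ∧ w⁻¹ p.2 < w⁻¹ p.1).card

lemma adjSwap_apply (j i : ℕ) :
    adjSwap j i = if i = j then j + 1 else if i = j + 1 then j else i :=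
  Equiv.swap_apply_def ..

@[simp] lemma adjSwap_inv (j : ℕ) : (adjSwap j)⁻¹ = adjSwap j := Equiv.swap_inv ..

@[simp] lemma adjSwap_mul_cancel_left (j : ℕ) (w : Equiv.Perm ℕ) :
    adjSwap j * (adjSwap j * w) = w := Equiv.swap_mul_self_mul ..

lemma adjSwap_mul_inv_apply (j : ℕ) (w : Equiv.Perm ℕ) (i : ℕ) :
    (adjSwap j * w)⁻¹ i = w⁻¹ (adjSwap j i) := by
  simp [mul_inv_rev]

lemma adjSwap_comm {i j : ℕ} (h : i + 1 < j) :
    adjSwap i * adjSwap j = adjSwap j * adjSwap i := by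
  ext k
  simp only [Equiv.Perm.mul_apply, adjSwap_apply]
  grind

lemma adjSwap_braid (i : ℕ) :
    adjSwap i * adjSwap (i + 1) * adjSwap i =
      adjSwap (i + 1) * adjSwap i * adjSwap (i + 1) := by
  ext k
  simp only [Equiv.Perm.mul_apply, adjSwap_apply]
  grind

@[simp] lemma wordPerm_nil : wordPerm [] = 1 := rfl

@[simp] lemma wordPerm_cons (j : ℕ) (L : List ℕ) :
    wordPerm (j :: L) = adjSwap j * wordPerm L := by
  simp [wordPerm]

lemma wordPerm_append (L M : List ℕ) : wordPerm (L ++ M) = wordPerm L * wordPerm M := by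
  simp [wordPerm]

@[simp] lemma invCount_one (n : ℕ) : invCount n 1 = 0 := by
  simp only [invCount, Finset.card_eq_zero, Finset.filter_eq_empty_iff]
  simp only [inv_one, Equiv.Perm.one_apply]
  intro p _
  omega

lemma invCount_adjSwap_mul_of_lt {n j : ℕ} (hj : j + 1 < n) {w : Equiv.Perm ℕ}
    (h : w⁻¹ j < w⁻¹ (j + 1)) : invCount n (adjSwap j * w) = invCount n w + 1 := by
  generalize hs : adjSwap j = s
  have hinvol : ∀ i, s (s i) = i := hs ▸ fun i => Equiv.swap_apply_self j (j + 1) i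
  have hval : ∀ i, s i = if i = j then j + 1 else if i = j + 1 then j else i :=
    hs ▸ adjSwap_apply j
  have hmul : ∀ i, (s * w)⁻¹ i = w⁻¹ (s i) := hs ▸ adjSwap_mul_inv_apply j w
  unfold invCount
  simp only [hmul]
  clear hmul
  generalize w⁻¹ = v at h ⊢
  have key : ((Finset.range n ×ˢ Finset.range n).filter
        fun p => p.1 < p.2 ∧ v (s p.2) < v (s p.1)) =
      insert (j, j + 1) (((Finset.range n ×ˢ Finset.range n).filter
        fun p => p.1 < p.2 ∧ v p.2 < v p.1).map (s.prodCongr s).toEmbedding) := by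
    ext ⟨a, b⟩
    simp only [Finset.mem_filter, Finset.mem_insert, Finset.mem_map, Finset.mem_product,
      Finset.mem_range, Prod.mk.injEq, Prod.exists, Equiv.coe_toEmbedding, Equiv.prodCongr_apply,
      Prod.map_apply]
    constructor
    · rintro ⟨⟨ha, hb⟩, hab, hlt⟩
      by_cases hc : a = j ∧ b = j + 1
      · exact Or.inl hc
      · refine Or.inr ⟨s a, s b, ⟨⟨?_, ?_⟩, ?_, hlt⟩, hinvol a, hinvol b⟩ <;> grind
    · rintro (⟨ha, hb⟩ | ⟨c, d, ⟨⟨hc, hd⟩, hcd, hlt⟩, rfl, rfl⟩)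
      · subst ha hb
        exact ⟨⟨by omega, hj⟩, by omega, by simpa [hval] using h⟩
      · rw [hinvol, hinvol]
        have hne : ¬ (c = j ∧ d = j + 1) := by
          rintro ⟨hc, hd⟩
          subst hc hd
          omega
        refine ⟨⟨?_, ?_⟩, ?_, hlt⟩ <;> grind
  rw [key, Finset.card_insert_of_notMem, Finset.card_map]
  simp only [Finset.mem_map, Finset.mem_filter, Prod.exists, Equiv.coe_toEmbedding,
    Equiv.prodCongr_apply, Prod.map_apply, Prod.mk.injEq, not_exists, not_and]
  intro c d hcd hc hd
  have := hinvol c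
  have := hinvol d
  grind

lemma invCount_adjSwap_mul_of_gt {n j : ℕ} (hj : j + 1 < n) {w : Equiv.Perm ℕ}
    (h : w⁻¹ (j + 1) < w⁻¹ j) : invCount n (adjSwap j * w) + 1 = invCount n w := by
  have := invCount_adjSwap_mul_of_lt (w := adjSwap j * w) hj
    (by simpa [adjSwap_mul_inv_apply, adjSwap_apply] using h)
  rw [← this, adjSwap_mul_cancel_left]

lemma invCount_adjSwap_mul_le {n j : ℕ} (hj : j + 1 < n) (w : Equiv.Perm ℕ) :
    invCount n (adjSwap j * w) ≤ invCount n w + 1 := by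
  rcases lt_or_gt_of_ne (w⁻¹.injective.ne (Nat.succ_ne_self j)) with h | h
  · have := invCount_adjSwap_mul_of_gt hj h
    omega
  · exact (invCount_adjSwap_mul_of_lt hj h).le

lemma invCount_wordPerm_le {n : ℕ} {L : List ℕ} (hL : ∀ j ∈ L, j + 1 < n) :
    invCount n (wordPerm L) ≤ L.length := by
  induction L with
  | nil => simp
  | cons j L ih =>
    rw [List.forall_mem_cons] at hL
    have := invCount_adjSwap_mul_le hL.1 (wordPerm L)
    have := ih hL.2
    simp only [wordPerm_cons, List.length_cons]
    omega

lemma wordPerm_apply_of_le {n : ℕ} {L : List ℕ} (hL : ∀ j ∈ L, j + 1 < n) {i : ℕ}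
    (hi : n ≤ i) : wordPerm L i = i := by
  induction L with
  | nil => simp
  | cons j L ih =>
    rw [List.forall_mem_cons] at hL
    rw [wordPerm_cons, Equiv.Perm.mul_apply, ih hL.2, adjSwap_apply, if_neg (by omega),
      if_neg (by omega)]

/-- A permutation of `ℕ` supported on `{0, …, n - 1}` without descents is trivial. -/
lemma eq_one_of_forall_lt {n : ℕ} {w : Equiv.Perm ℕ} (hw : ∀ i, n ≤ i → w i = i)
    (h : ∀ j, j + 1 < n → w⁻¹ j < w⁻¹ (j + 1)) : w = 1 := by
  have hw' : ∀ i, n ≤ i → w⁻¹ i = i := fun i hi => by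
    rw [Equiv.Perm.inv_eq_iff_eq, hw i hi]
  have hmono : StrictMono (w⁻¹ : Equiv.Perm ℕ) := by
    refine strictMono_nat_of_lt_succ fun j => ?_
    rcases lt_or_ge (j + 1) n with hj | hj
    · exact h j hj
    · rw [hw' (j + 1) hj]
      by_contra! hlt
      have h1 := hw _ (hj.trans hlt)
      simp only [Equiv.Perm.coe_inv, Equiv.apply_symm_apply] at h1 hlt
      omega
  have hmono' : StrictMono w := fun a b hab => by
    rw [← hmono.lt_iff_lt]
    simpa using hab
  ext i
  refine le_antisymm ?_ (hmono'.le_apply (x := i))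
  simpa using hmono.le_apply (x := w i)

/-- Every permutation supported on `{0, …, n - 1}` has a word of length `invCount n w`. -/
lemma exists_word {n : ℕ} {w : Equiv.Perm ℕ} (hw : ∀ i, n ≤ i → w i = i) :
    ∃ L : List ℕ, (∀ j ∈ L, j + 1 < n) ∧ wordPerm L = w ∧ L.length = invCount n w := by
  induction hN : invCount n w generalizing w with
  | zero =>
    refine ⟨[], by simp, ?_, rfl⟩
    refine (eq_one_of_forall_lt hw fun j hj => ?_).symm
    by_contra! hle
    have := invCount_adjSwap_mul_of_gt hj
      (lt_of_le_of_ne hle (w⁻¹.injective.ne (Nat.succ_ne_self j)))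
    omega
  | succ N ih =>
    obtain ⟨j, hj, hlt⟩ : ∃ j, j + 1 < n ∧ w⁻¹ (j + 1) < w⁻¹ j := by
      by_contra! hle
      have := eq_one_of_forall_lt hw fun j hj =>
        lt_of_le_of_ne (hle j hj) (w⁻¹.injective.ne (Nat.succ_ne_self j).symm)
      simp [this] at hN
    have hcount := invCount_adjSwap_mul_of_gt hj hlt
    obtain ⟨L, hL, hLw, hlen⟩ := ih (w := adjSwap j * w)
      (fun i hi => by
        rw [Equiv.Perm.mul_apply, hw i hi, adjSwap_apply, if_neg (by omega), if_neg (by omega)])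
      (by omega)
    exact ⟨j :: L, List.forall_mem_cons.2 ⟨hj, hL⟩, by simp [hLw], by simp [hlen]⟩

/-- A word is reduced if it has as many letters as its permutation has inversions. -/
structure IsReducedWord (n : ℕ) (L : List ℕ) : Prop where
  lt : ∀ j ∈ L, j + 1 < n
  length_eq : invCount n (wordPerm L) = L.length

namespace IsReducedWord

variable {n : ℕ}

lemma of_cons {j : ℕ} {L : List ℕ} (h : IsReducedWord n (j :: L)) : IsReducedWord n L := by
  obtain ⟨hj, hL⟩ := List.forall_mem_cons.1 h.lt
  have h1 := h.length_eq
  have h2 := invCount_wordPerm_le hL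
  have h3 := invCount_adjSwap_mul_le hj (wordPerm L)
  simp only [wordPerm_cons, List.length_cons] at h1
  exact ⟨hL, by omega⟩

lemma descent {j : ℕ} {L : List ℕ} (h : IsReducedWord n (j :: L)) :
    (wordPerm (j :: L))⁻¹ (j + 1) < (wordPerm (j :: L))⁻¹ j := by
  have hj := h.lt j (by simp)
  by_contra! hle
  have h1 := invCount_adjSwap_mul_of_lt hj
    (lt_of_le_of_ne hle ((wordPerm (j :: L))⁻¹.injective.ne (Nat.succ_ne_self j).symm))
  rw [wordPerm_cons, adjSwap_mul_cancel_left, ← wordPerm_cons, h.length_eq,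
    h.of_cons.length_eq] at h1
  simp only [List.length_cons] at h1
  omega

/-- A reduced word can be replaced by one starting with a given left descent. -/
lemma exists_cons {j : ℕ} {L : List ℕ} (h : IsReducedWord n L) (hj : j + 1 < n)
    (hlt : (wordPerm L)⁻¹ (j + 1) < (wordPerm L)⁻¹ j) :
    ∃ U, IsReducedWord n (j :: U) ∧ wordPerm (j :: U) = wordPerm L := by
  obtain ⟨U, hU, hUw, hlen⟩ := exists_word (n := n) (w := adjSwap j * wordPerm L) fun i hi => by
    rw [← wordPerm_cons]
    exact wordPerm_apply_of_le (List.forall_mem_cons.2 ⟨hj, h.lt⟩) hi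
  have hprod : wordPerm (j :: U) = wordPerm L := by simp [hUw]
  refine ⟨U, ⟨List.forall_mem_cons.2 ⟨hj, hU⟩, ?_⟩, hprod⟩
  rw [hprod, List.length_cons, hlen, invCount_adjSwap_mul_of_gt hj hlt]

lemma length_eq_of_wordPerm_eq {L M : List ℕ} (hL : IsReducedWord n L) (hM : IsReducedWord n M)
    (h : wordPerm L = wordPerm M) : L.length = M.length := by
  rw [← hL.length_eq, h, hM.length_eq]

lemma of_wordPerm_eq {L M : List ℕ} (hL : IsReducedWord n L) (hM : ∀ j ∈ M, j + 1 < n)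
    (h : wordPerm M = wordPerm L) (hlen : M.length = L.length) : IsReducedWord n M :=
  ⟨hM, by rw [h, hL.length_eq, hlen]⟩

/-- Matsumoto's theorem for the symmetric group: a family of monoid elements satisfying the braid
relations takes the same product along any two reduced words of a permutation. -/
theorem prod_map_eq {A : Type*} [Monoid A] {p : ℕ → A}
    (hcomm : ∀ i j, i + 1 < j → j + 1 < n → p i * p j = p j * p i)
    (hbraid : ∀ i, i + 2 < n → p i * p (i + 1) * p i = p (i + 1) * p i * p (i + 1))
    {L M : List ℕ} (hL : IsReducedWord n L) (hM : IsReducedWord n M)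
    (h : wordPerm L = wordPerm M) : (L.map p).prod = (M.map p).prod := by
  induction hN : L.length generalizing L M with
  | zero =>
    have hlen := hL.length_eq_of_wordPerm_eq hM h
    rw [List.length_eq_zero_iff.1 hN, List.length_eq_zero_iff.1 (hlen.symm.trans hN)]
  | succ N ih =>
    have hlen := hL.length_eq_of_wordPerm_eq hM h
    obtain ⟨i, L, rfl⟩ := List.exists_cons_of_length_eq_add_one hN
    obtain ⟨j, M, rfl⟩ := List.exists_cons_of_length_eq_add_one (hlen.symm.trans hN)
    simp only [List.length_cons] at hlen hN
    have hi := hL.lt i (by simp)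
    have hj := hM.lt j (by simp)
    have hdi := hL.descent
    have hdj := hM.descent
    rw [← h] at hdj
    wlog hij : i ≤ j generalizing i j L M
    · refine (this j M hM (by omega) i L hL h.symm (by omega) hj hi ?_ ?_ (by omega)).symm
      · rwa [← h]
      · rwa [← h]
    simp only [List.map_cons, List.prod_cons]
    obtain rfl | hlt := hij.eq_or_lt
    · rw [ih hL.of_cons hM.of_cons (by simpa using h) (by omega)]
    have hw : adjSwap i * (wordPerm (i :: L)) = wordPerm L := by simp
    have key : ∀ k, (wordPerm L)⁻¹ k = (wordPerm (i :: L))⁻¹ (adjSwap i k) := fun k => by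
      rw [← hw, adjSwap_mul_inv_apply]
    obtain ⟨U, hU, hUL⟩ := hL.of_cons.exists_cons (j := j) hj (by
      rw [key, key, adjSwap_apply, adjSwap_apply]
      grind)
    have key' : ∀ k, (wordPerm U)⁻¹ k = (wordPerm L)⁻¹ (adjSwap j k) := fun k => by
      rw [← hUL, wordPerm_cons, adjSwap_mul_inv_apply]
      simp only [adjSwap_apply]
      grind
    have hMU : wordPerm M = adjSwap j * (adjSwap i * (adjSwap j * wordPerm U)) := by
      rw [← wordPerm_cons, hUL, ← wordPerm_cons, h, wordPerm_cons, adjSwap_mul_cancel_left]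
    have hlenU := hL.of_cons.length_eq_of_wordPerm_eq hU hUL.symm
    have hUlt := hU.of_cons.lt
    obtain rfl | hlt' := (Nat.succ_le_of_lt hlt).eq_or_lt
    · obtain ⟨V, hV, hVU⟩ := hU.of_cons.exists_cons (j := i) hi (by
        simp only [key', key, adjSwap_apply]
        grind)
      have hlenV := hU.of_cons.length_eq_of_wordPerm_eq hV hVU.symm
      have hVlt := hV.of_cons.lt
      simp only [List.length_cons] at hlenU hlenV
      have hVL : wordPerm ((i + 1) :: i :: V) = wordPerm L := by
        rw [wordPerm_cons, hVU, ← wordPerm_cons, hUL]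
      have hVM : wordPerm (i :: (i + 1) :: V) = wordPerm M := by
        have := congrArg (· * wordPerm (i :: V)) (adjSwap_braid i)
        simpa [hMU, ← hVU, mul_assoc] using this
      rw [ih hL.of_cons (hL.of_cons.of_wordPerm_eq (by grind) hVL (by grind)) hVL.symm (by omega),
        ih hM.of_cons (hM.of_cons.of_wordPerm_eq (by grind) hVM (by grind)) hVM.symm (by omega)]
      simp only [List.map_cons, List.prod_cons, ← mul_assoc, Nat.succ_eq_add_one]
      rw [hbraid i hj]
    · simp only [List.length_cons] at hlenU
      have hUM : wordPerm (i :: U) = wordPerm M := by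
        rw [hMU, ← mul_assoc (adjSwap i), adjSwap_comm hlt']
        simp [mul_assoc]
      rw [ih hL.of_cons hU hUL.symm (by omega),
        ih hM.of_cons (hM.of_cons.of_wordPerm_eq (by grind) hUM (by grind)) hUM.symm (by omega),
        List.map_cons, List.map_cons, List.prod_cons, List.prod_cons, ← mul_assoc, ← mul_assoc,
        hcomm i j hlt' hj]

end IsReducedWord

/-- The word `k - 1, …, 1, 0`. -/
def descWord : ℕ → List ℕ
  | 0 => []
  | k + 1 => k :: descWord k

/-- A reduced word of the order-reversing permutation of `{0, …, m - 1}`. -/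
def longestWord : ℕ → List ℕ
  | 0 => []
  | m + 1 => longestWord m ++ descWord m

lemma lt_of_mem_descWord {k j : ℕ} (h : j ∈ descWord k) : j < k := by
  induction k with
  | zero => simp [descWord] at h
  | succ k ih =>
    rcases List.mem_cons.1 h with rfl | h
    · omega
    · exact (ih h).trans k.lt_succ_self

lemma succ_lt_of_mem_longestWord {m j : ℕ} (h : j ∈ longestWord m) : j + 1 < m := by
  induction m with
  | zero => simp [longestWord] at h
  | succ m ih =>
    rcases List.mem_append.1 h with h | h
    · exact (ih h).trans m.lt_succ_self
    · exact Nat.succ_lt_succ (lt_of_mem_descWord h)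

lemma length_descWord (k : ℕ) : (descWord k).length = k := by
  induction k with
  | zero => rfl
  | succ k ih => simp [descWord, ih]

lemma length_longestWord (m : ℕ) : (longestWord m).length = ∑ k ∈ Finset.range m, k := by
  induction m with
  | zero => rfl
  | succ m ih => simp [longestWord, ih, length_descWord, Finset.sum_range_succ]

lemma wordPerm_descWord_apply (k i : ℕ) :
    wordPerm (descWord k) i = if i = 0 then k else if i ≤ k then i - 1 else i := by
  induction k with
  | zero =>
    simp [descWord]
    grind
  | succ k ih =>
    rw [descWord, wordPerm_cons, Equiv.Perm.mul_apply, ih, adjSwap_apply]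
    grind

lemma wordPerm_longestWord_apply (m i : ℕ) :
    wordPerm (longestWord m) i = if i < m then m - 1 - i else i := by
  induction m generalizing i with
  | zero => simp [longestWord]
  | succ m ih =>
    rw [longestWord, wordPerm_append, Equiv.Perm.mul_apply, ih, wordPerm_descWord_apply]
    grind

lemma wordPerm_longestWord_inv_apply {n i : ℕ} (hi : i < n) :
    (wordPerm (longestWord n))⁻¹ i = n - 1 - i := by
  rw [Equiv.Perm.inv_eq_iff_eq, wordPerm_longestWord_apply, if_pos (by omega)]
  omega

lemma isReducedWord_longestWord (n : ℕ) : IsReducedWord n (longestWord n) := by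
  refine ⟨fun j => succ_lt_of_mem_longestWord, ?_⟩
  rw [length_longestWord, invCount, Finset.card_filter, Finset.sum_product_right]
  refine Finset.sum_congr rfl fun b hb => ?_
  rw [Finset.mem_range] at hb
  rw [← Finset.card_filter]
  conv_rhs => rw [← Finset.card_range b]
  congr 1
  ext a
  simp only [Finset.mem_filter, Finset.mem_range]
  constructor
  · exact fun h => h.2.1
  · intro h
    rw [wordPerm_longestWord_inv_apply hb, wordPerm_longestWord_inv_apply (h.trans hb)]
    omega

section Monomials

variable {A : Type*} [Ring A]

/-- The monomial `x_0 ^ α_0 ⋯ x_{n-1} ^ α_{n-1}`, multiplied out from left to right. -/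
def listMonomial (n : ℕ) (x : ℕ → A) (α : ℕ → ℕ) : A :=
  ((List.range n).map fun i => x i ^ α i).prod

variable {n : ℕ} {x p : ℕ → A}

lemma listMonomial_succ (n : ℕ) (x : ℕ → A) (α : ℕ → ℕ) :
    listMonomial (n + 1) x α = listMonomial n x α * x n ^ α n := by
  simp [listMonomial, List.range_succ]

lemma commute_listMonomial {a : A} {α : ℕ → ℕ} (h : ∀ i, i < n → α i ≠ 0 → Commute a (x i)) :
    Commute a (listMonomial n x α) := by
  refine Commute.list_prod_right _ _ fun b hb => ?_
  obtain ⟨i, hi, rfl⟩ := List.mem_map.1 hb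
  by_cases h0 : α i = 0
  · simp [h0]
  · exact (h i (List.mem_range.1 hi) h0).pow_right _

lemma listMonomial_add (hx : ∀ i j, Commute (x i) (x j)) (α β : ℕ → ℕ) :
    listMonomial n x (α + β) = listMonomial n x α * listMonomial n x β := by
  induction n with
  | zero => simp [listMonomial]
  | succ n ih =>
    have hc : Commute (x n ^ α n) (listMonomial n x β) :=
      commute_listMonomial fun i _ _ => (hx n i).pow_left _
    rw [listMonomial_succ, listMonomial_succ, listMonomial_succ, ih, Pi.add_apply, pow_add,
      mul_assoc, mul_assoc, ← mul_assoc (x n ^ α n) (listMonomial n x β), hc.eq, mul_assoc]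

lemma listMonomial_single {j : ℕ} (hj : j < n) (a : ℕ) :
    listMonomial n x (Pi.single j a) = x j ^ a := by
  induction n with
  | zero => omega
  | succ n ih =>
    rw [listMonomial_succ]
    rcases (Nat.lt_succ_iff.1 hj).eq_or_lt with rfl | hlt
    · have : listMonomial j x (Pi.single j a) = 1 := by
        refine List.prod_eq_one fun b hb => ?_
        obtain ⟨i, hi, rfl⟩ := List.mem_map.1 hb
        simp [(List.mem_range.1 hi).ne]
      simp [this]
    · simp [ih hlt, hlt.ne']

/-- The nilHecke relations for families indexed by `ℕ`, imposed on the crossings `p j` with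
`j + 1 < n`. -/
structure NilHeckeRelations (n : ℕ) (x p : ℕ → A) : Prop where
  commute_x : ∀ i j, Commute (x i) (x j)
  commute_p_x : ∀ j k, j + 1 < n → k ≠ j → k ≠ j + 1 → Commute (p j) (x k)
  p_mul_p_comm : ∀ i j, i + 1 < j → j + 1 < n → p i * p j = p j * p i
  p_mul_self : ∀ j, j + 1 < n → p j * p j = 0
  braid : ∀ i, i + 2 < n → p i * p (i + 1) * p i = p (i + 1) * p i * p (i + 1)
  x_mul_p : ∀ j, j + 1 < n → x j * p j = p j * x (j + 1) + 1
  p_mul_x : ∀ j, j + 1 < n → p j * x j = x (j + 1) * p j + 1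

namespace NilHeckeRelations

lemma commute_p_mul (R : NilHeckeRelations n x p)
    {j : ℕ} (hj : j + 1 < n) : Commute (p j) (x j * x (j + 1)) := by
  have h1 := R.x_mul_p j hj
  have h2 := R.p_mul_x j hj
  calc p j * (x j * x (j + 1)) = x (j + 1) * (p j * x (j + 1) + 1) := by
        rw [← mul_assoc, h2, add_mul, mul_add, one_mul, mul_one, mul_assoc]
    _ = x j * x (j + 1) * p j := by
        rw [← h1, ← mul_assoc, (R.commute_x (j + 1) j).eq]

/-- Monomials symmetric in `x j` and `x (j + 1)` commute with the crossing `p j`. -/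
lemma commute_p_listMonomial (R : NilHeckeRelations n x p)
    {j : ℕ} (hj : j + 1 < n) {α : ℕ → ℕ} (hα : α j = α (j + 1)) :
    Commute (p j) (listMonomial n x α) := by
  let β : ℕ → ℕ := fun i => if i = j ∨ i = j + 1 then 0 else α i
  have hαβ : α = β + (Pi.single j (α j) + Pi.single (j + 1) (α j)) := by
    ext i
    simp only [β, Pi.add_apply, Pi.single_apply]
    grind
  rw [hαβ, listMonomial_add R.commute_x, listMonomial_add R.commute_x,
    listMonomial_single (by omega), listMonomial_single hj, ← (R.commute_x j (j + 1)).mul_pow]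
  refine Commute.mul_right (commute_listMonomial fun i _ hi => ?_)
    ((R.commute_p_mul hj).pow_right _)
  simp only [β] at hi
  exact R.commute_p_x j i hj (by grind) (by grind)

/-- The divided difference of `x j * m` with `m` symmetric, applied to an element killed by the
crossing `p j`. -/
lemma p_mul_listMonomial_mul (R : NilHeckeRelations n x p)
    {j : ℕ} (hj : j + 1 < n) {E : A} (hE : p j * E = 0) {α : ℕ → ℕ}
    (hα : α j = α (j + 1)) :
    p j * (listMonomial n x (Pi.single j 1 + α) * E) = listMonomial n x α * E := by
  have hc := R.commute_p_listMonomial hj hα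
  rw [listMonomial_add R.commute_x, listMonomial_single (by omega), pow_one, mul_assoc,
    ← mul_assoc, R.p_mul_x j hj, add_mul, one_mul, mul_assoc, ← mul_assoc (p j), hc.eq, mul_assoc,
    hE, mul_zero, mul_zero, zero_add]

lemma descWord_mul_listMonomial_mul (R : NilHeckeRelations n x p)
    {E : A} (hE : ∀ j, j + 1 < n → p j * E = 0) {m k : ℕ}
    (hm : m ≤ n) (hk : k + 1 ≤ m) :
    ((descWord k).map p).prod * (listMonomial n x (fun i => m - 1 - i) * E) =
      listMonomial n x (fun i => if i < k then m - 2 - i else m - 1 - i) * E := by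
  induction k with
  | zero => simp [descWord]
  | succ k ih =>
    have hsplit : (fun i => if i < k then m - 2 - i else m - 1 - i) =
        Pi.single k 1 + fun i => if i < k + 1 then m - 2 - i else m - 1 - i := by
      ext i
      simp only [Pi.add_apply, Pi.single_apply]
      grind
    rw [descWord, List.map_cons, List.prod_cons, mul_assoc, ih (by omega), hsplit,
      R.p_mul_listMonomial_mul (by omega) (hE k (by omega))]
    grind

lemma longestWord_mul_listMonomial_mul (R : NilHeckeRelations n x p)
    {E : A} (hE : ∀ j, j + 1 < n → p j * E = 0) {m : ℕ}
    (hm : m ≤ n) :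
    ((longestWord m).map p).prod * (listMonomial n x (fun i => m - 1 - i) * E) = E := by
  induction m with
  | zero => simp [longestWord, listMonomial]
  | succ m ih =>
    have hstair : (fun i => if i < m then m + 1 - 2 - i else m + 1 - 1 - i) =
        fun i => m - 1 - i := by
      ext i
      grind
    rw [longestWord, List.map_append, List.prod_append, mul_assoc,
      R.descWord_mul_listMonomial_mul hE hm le_rfl, hstair, ih (by omega)]

lemma p_mul_longestWord (R : NilHeckeRelations n x p)
    {j : ℕ} (hj : j + 1 < n) : p j * ((longestWord n).map p).prod = 0 := by
  have hred := isReducedWord_longestWord n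
  obtain ⟨U, hU, hUw⟩ := hred.exists_cons hj (by
    rw [wordPerm_longestWord_inv_apply hj, wordPerm_longestWord_inv_apply (by omega)]
    omega)
  rw [hred.prod_map_eq R.p_mul_p_comm R.braid hU hUw.symm, List.map_cons, List.prod_cons,
    ← mul_assoc, R.p_mul_self j hj, zero_mul]

theorem isIdempotentElem (R : NilHeckeRelations n x p) {L : List ℕ} (hL : IsReducedWord n L)
    (hw : wordPerm L = wordPerm (longestWord n)) :
    IsIdempotentElem (listMonomial n x (fun i => n - 1 - i) * (L.map p).prod) := by
  rw [hL.prod_map_eq R.p_mul_p_comm R.braid (isReducedWord_longestWord n) hw, IsIdempotentElem,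
    mul_assoc, R.longestWord_mul_listMonomial_mul (fun j hj => R.p_mul_longestWord hj) le_rfl]

end NilHeckeRelations

end Monomials

/-- The dots of `NH_n`, extended by zero to `ℕ`. -/
def natX (𝕜 : Type) [Field 𝕜] (n : ℕ) (j : ℕ) : NH 𝕜 n :=
  if h : j < n then xN 𝕜 n ⟨j, h⟩ else 0

/-- The crossings of `NH_n`, extended by zero to `ℕ`. -/
def natP (𝕜 : Type) [Field 𝕜] (n : ℕ) (j : ℕ) : NH 𝕜 n :=
  if h : j < n - 1 then pN 𝕜 n ⟨j, h⟩ else 0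

lemma nhMk_eq_of_rel {𝕜 : Type} [Field 𝕜] {n : ℕ} {a b : FreeAlgebra 𝕜 (NHGen n)}
    (h : NHRel 𝕜 n a b) : nhMk 𝕜 n a = nhMk 𝕜 n b :=
  RingQuot.mkAlgHom_rel 𝕜 h

lemma natX_of_lt {𝕜 : Type} [Field 𝕜] {n j : ℕ} (h : j < n) :
    natX 𝕜 n j = nhMk 𝕜 n (XNf 𝕜 n ⟨j, h⟩) := dif_pos h

lemma natP_of_lt {𝕜 : Type} [Field 𝕜] {n j : ℕ} (h : j < n - 1) :
    natP 𝕜 n j = nhMk 𝕜 n (PNf 𝕜 n ⟨j, h⟩) := dif_pos h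

lemma nilHeckeRelations_NH (𝕜 : Type) [Field 𝕜] (n : ℕ) :
    NilHeckeRelations n (natX 𝕜 n) (natP 𝕜 n) where
  commute_x i j := by
    by_cases hi : i < n
    · by_cases hj : j < n
      · rw [natX_of_lt hi, natX_of_lt hj, Commute, SemiconjBy, ← map_mul, ← map_mul]
        exact nhMk_eq_of_rel (.xx _ _)
      · simp [natX, hj]
    · simp [natX, hi]
  commute_p_x j k hj h1 h2 := by
    by_cases hk : k < n
    · rw [natX_of_lt hk, natP_of_lt (by omega), Commute, SemiconjBy, ← map_mul, ← map_mul]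
      exact nhMk_eq_of_rel (.psix _ _ (fun h => h1 (congrArg Fin.val h))
        (fun h => h2 (congrArg Fin.val h)))
    · simp [natX, hk]
  p_mul_p_comm i j hij hj := by
    rw [natP_of_lt (by omega), natP_of_lt (by omega), ← map_mul, ← map_mul]
    exact nhMk_eq_of_rel (.psipsi _ _ hij)
  p_mul_self j hj := by
    rw [natP_of_lt (by omega), ← map_mul, nhMk_eq_of_rel (.psisq _), map_zero]
  braid i hi := by
    rw [natP_of_lt (j := i) (by omega), natP_of_lt (j := i + 1) (by omega)]
    simp only [← map_mul]
    exact nhMk_eq_of_rel (.braid _ _ rfl)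
  x_mul_p j hj := by
    rw [natX_of_lt (j := j) (by omega), natX_of_lt hj, natP_of_lt (by omega), ← sub_eq_iff_eq_add',
      ← map_mul, ← map_mul, ← map_sub, ← map_one (nhMk 𝕜 n)]
    exact nhMk_eq_of_rel (.dot1 ⟨j, by omega⟩)
  p_mul_x j hj := by
    rw [natX_of_lt (j := j) (by omega), natX_of_lt hj, natP_of_lt (by omega), ← sub_eq_iff_eq_add',
      ← map_mul, ← map_mul, ← map_sub, ← map_one (nhMk 𝕜 n)]
    exact nhMk_eq_of_rel (.dot2 ⟨j, by omega⟩)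

lemma nhDots_eq (𝕜 : Type) [Field 𝕜] (n : ℕ) :
    nhDots 𝕜 n = listMonomial n (natX 𝕜 n) fun i => n - 1 - i := by
  rw [nhDots, listMonomial, ← List.map_coe_finRange_eq_range, List.map_map]
  refine congrArg List.prod (List.map_congr_left fun j _ => ?_)
  simp [natX]

lemma map_pN_eq (𝕜 : Type) [Field 𝕜] {n : ℕ} (L : List (Fin (n - 1))) :
    L.map (pN 𝕜 n) = (L.map Fin.val).map (natP 𝕜 n) := by
  rw [List.map_map]
  refine List.map_congr_left fun j _ => ?_
  simp [natP]

lemma val_prod_map_sSwap_apply {n : ℕ} (L : List (Fin (n - 1))) (i : Fin n) :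
    ((L.map sSwap).prod i : ℕ) = wordPerm (L.map Fin.val) i := by
  induction L with
  | nil => simp
  | cons j L ih =>
    simp only [List.map_cons, List.prod_cons, wordPerm_cons, Equiv.Perm.mul_apply, ← ih,
      adjSwap_apply, sSwap, Equiv.swap_apply_def, lpos, rpos, Fin.ext_iff, Fin.val_castLE]
    split_ifs <;> rfl

lemma succ_lt_of_mem_map_val {n : ℕ} {L : List (Fin (n - 1))} {j : ℕ} (h : j ∈ L.map Fin.val) :
    j + 1 < n := by
  obtain ⟨i, -, rfl⟩ := List.mem_map.1 h
  omega

/-- A word in the adjacent transpositions of `𝔖_n` represents `w_0` if and only if it represents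
the same permutation of `ℕ` as `longestWord n`. -/
lemma prod_map_sSwap_eq_revPerm_iff {n : ℕ} (L : List (Fin (n - 1))) :
    (L.map sSwap).prod = (Fin.revPerm : Equiv.Perm (Fin n)) ↔
      wordPerm (L.map Fin.val) = wordPerm (longestWord n) := by
  have hrev : ∀ i : Fin n, (Fin.revPerm i : ℕ) = wordPerm (longestWord n) i := fun i => by
    rw [wordPerm_longestWord_apply, if_pos i.isLt, Fin.revPerm_apply, Fin.val_rev]
    omega
  constructor
  · intro h
    ext i
    rcases lt_or_ge i n with hi | hi
    · have := val_prod_map_sSwap_apply L ⟨i, hi⟩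
      rw [h, hrev] at this
      exact this.symm
    · rw [wordPerm_apply_of_le (fun _ => succ_lt_of_mem_map_val) hi,
        wordPerm_longestWord_apply, if_neg (by omega)]
  · intro h
    ext i
    rw [val_prod_map_sSwap_apply, h, hrev]

/-- `e_n = x_1^{n−1} x_2^{n−2} ⋯ x_{n−1} ψ_{w_0}` is an idempotent of
`NH_n`, for any reduced expression `L` of the longest element `w_0` of `𝔖_n`
(the order-reversing permutation `Fin.revPerm`). -/
theorem e_n_idempotent (𝕜 : Type) [Field 𝕜] (n : ℕ) (hn : 1 ≤ n)
    (L : List (Fin (n - 1)))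
    (hL : (L.map sSwap).prod = (Fin.revPerm : Equiv.Perm (Fin n)))
    (hred : ∀ L' : List (Fin (n - 1)),
      (L'.map sSwap).prod = (Fin.revPerm : Equiv.Perm (Fin n)) → L.length ≤ L'.length) :
    nhE 𝕜 n L * nhE 𝕜 n L = nhE 𝕜 n L := by
  have hw := (prod_map_sSwap_eq_revPerm_iff L).1 hL
  have hlt : ∀ j ∈ L.map Fin.val, j + 1 < n := fun _ => succ_lt_of_mem_map_val
  have hlong := isReducedWord_longestWord n
  let L' : List (Fin (n - 1)) := (longestWord n).pmap Fin.mk fun j hj => by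
    have := hlong.lt j hj
    omega
  have hL' : L'.map Fin.val = longestWord n := by
    simp [L', List.map_pmap]
  have hle : L.length ≤ (longestWord n).length := by
    have := hred L' ((prod_map_sSwap_eq_revPerm_iff L').2 (by rw [hL']))
    simpa [L'] using this
  have hcount := invCount_wordPerm_le hlt
  rw [hw, hlong.length_eq, List.length_map] at hcount
  have hLred : IsReducedWord n (L.map Fin.val) :=
    hlong.of_wordPerm_eq hlt hw (by rw [List.length_map]; omega)
  rw [nhE, nhDots_eq, map_pN_eq]
  exact (nilHeckeRelations_NH 𝕜 n).isIdempotentElem hLred hw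

end Statement56

end
end
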